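/- Let λ>0 and 1=q<p<∞, and let v be a non-negative measurable weight on (0,∞). Then the Laplace-type operator 𝓛 is compact from L^p to L^1 if and only if B_p=(∫_0^∞ y^{−λ p'} v(y)^{p'} dy)^{1/p'} < ∞. -/

import Mathlib

open MeasureTheory Set Filter Topology
open scoped ENNReal NNReal

noncomputable section

/-- The Laplace-type operator `𝓛f(x) = ∫_0^∞ e^{-x y^λ} f(y) v(y) dy`. -/
def Lap (lam : ℝ) (v f : ℝ → ℝ) : ℝ → ℝ :=
  fun x => ∫ y in Ioi (0:ℝ), Real.exp (-(x * y ^ lam)) * f y * v y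

/-- `(∫_0^∞ |g|^r)^{1/r}`, the `L^r(0,∞)` (quasi-)norm. -/
def eN (r : ℝ) (g : ℝ → ℝ) : ℝ≥0∞ :=
  (∫⁻ x in Ioi (0:ℝ), ENNReal.ofReal |g x| ^ r) ^ (1/r)

/-- Compactness of the Laplace-type operator from `L^p` to `L^q` (`q ≥ 1`): the image of the
closed unit ball of `L^p` is relatively compact in the complete space `L^q`; equivalently,
every sequence of the unit ball has a subsequence whose image is Cauchy in the `L^q` norm. -/
def LapCompact (lam p q : ℝ) (v : ℝ → ℝ) : Prop :=
  ∀ f : ℕ → ℝ → ℝ, (∀ n, Measurable (f n)) → (∀ n, eN p (f n) ≤ 1) →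
    ∃ φ : ℕ → ℕ, StrictMono φ ∧
      ∀ ε : ℝ, 0 < ε → ∃ N : ℕ, ∀ m, N ≤ m → ∀ n, N ≤ n →
        eN q (fun x => Lap lam v (f (φ m)) x - Lap lam v (f (φ n)) x) < ENNReal.ofReal ε

theorem eN_eq_eLpNorm {r : ℝ} (hr : 0 < r) (g : ℝ → ℝ) :
    eN r g = eLpNorm g (ENNReal.ofReal r) (volume.restrict (Ioi 0)) := by
  rw [eLpNorm_eq_lintegral_rpow_enorm_toReal (by simpa using hr) ENNReal.ofReal_ne_top,
    ENNReal.toReal_ofReal hr.le, eN]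
  simp only [Real.enorm_eq_ofReal_abs]

theorem lintegral_exp_neg_mul_Ioi {t : ℝ} (ht : 0 < t) :
    ∫⁻ x in Ioi (0:ℝ), ENNReal.ofReal (Real.exp (-(x * t))) = ENNReal.ofReal t⁻¹ := by
  have h := exp_neg_integrableOn_Ioi 0 ht
  have h2 := integral_exp_mul_Ioi (a := -t) (by linarith) 0
  rw [show (fun x : ℝ => ENNReal.ofReal (Real.exp (-(x * t))))
    = fun x => ENNReal.ofReal (Real.exp (-t * x)) from by ext x; ring_nf]
  rw [← ofReal_integral_eq_lintegral_ofReal h (ae_of_all _ fun x => (Real.exp_pos _).le), h2]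
  simp

/-- The weight `y^{-λ} v(y)` against which the `L^1` norm of `𝓛` is computed. -/
def redWeight (lam : ℝ) (v : ℝ → ℝ) : ℝ → ℝ := fun y => y ^ (-lam) * v y

theorem measurable_redWeight (lam : ℝ) {v : ℝ → ℝ} (hv : Measurable v) :
    Measurable (redWeight lam v) := by
  unfold redWeight
  fun_prop

theorem lintegral_lintegral_exp_mul {lam : ℝ} {v h : ℝ → ℝ} (hv : Measurable v)
    (hh : Measurable h) :
    ∫⁻ x in Ioi (0:ℝ), ∫⁻ y in Ioi (0:ℝ), ‖Real.exp (-(x * y ^ lam)) * h y * v y‖ₑ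
      = ∫⁻ y in Ioi (0:ℝ), ‖h y * redWeight lam v y‖ₑ := by
  rw [lintegral_lintegral_swap (by fun_prop)]
  refine setLIntegral_congr_fun measurableSet_Ioi fun y hy => ?_
  have hy : 0 < y := hy
  have e : ∀ x : ℝ, ‖Real.exp (-(x * y ^ lam)) * h y * v y‖ₑ
      = ENNReal.ofReal (Real.exp (-(x * y ^ lam))) * ‖h y * v y‖ₑ := fun x => by
    rw [mul_assoc, enorm_mul, Real.enorm_of_nonneg (Real.exp_pos _).le]
  simp only [e]
  rw [lintegral_mul_const _ (by fun_prop), lintegral_exp_neg_mul_Ioi (Real.rpow_pos_of_pos hy _),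
    ← Real.rpow_neg hy.le, ← Real.enorm_of_nonneg (Real.rpow_nonneg hy.le _), ← enorm_mul,
    redWeight]
  congr 1; ring

theorem lintegral_enorm_mul_le {α : Type*} [MeasurableSpace α] {μ : Measure α} {p q : ℝ}
    (hpq : p.HolderConjugate q) {f g : α → ℝ} (hf : AEMeasurable f μ) (hg : AEMeasurable g μ) :
    ∫⁻ a, ‖f a * g a‖ₑ ∂μ
      ≤ eLpNorm f (ENNReal.ofReal p) μ * eLpNorm g (ENNReal.ofReal q) μ := by
  rw [eLpNorm_eq_lintegral_rpow_enorm_toReal (by simpa using hpq.pos) ENNReal.ofReal_ne_top,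
    eLpNorm_eq_lintegral_rpow_enorm_toReal (by simpa using hpq.symm.pos) ENNReal.ofReal_ne_top,
    ENNReal.toReal_ofReal hpq.nonneg, ENNReal.toReal_ofReal hpq.symm.nonneg]
  simp only [enorm_mul]
  exact ENNReal.lintegral_mul_le_Lp_mul_Lq μ hpq hf.enorm hg.enorm

theorem eLpNorm_one_Lap_le {lam p q : ℝ} (hpq : p.HolderConjugate q) {v h : ℝ → ℝ}
    (hv : Measurable v) (hh : Measurable h) :
    eLpNorm (Lap lam v h) 1 (volume.restrict (Ioi 0))
      ≤ eLpNorm h (ENNReal.ofReal p) (volume.restrict (Ioi 0))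
        * eLpNorm (redWeight lam v) (ENNReal.ofReal q) (volume.restrict (Ioi 0)) := by
  rw [eLpNorm_one_eq_lintegral_enorm]
  calc _ ≤ ∫⁻ x in Ioi (0:ℝ), ∫⁻ y in Ioi (0:ℝ), ‖Real.exp (-(x * y ^ lam)) * h y * v y‖ₑ :=
        lintegral_mono fun x => enorm_integral_le_lintegral_enorm _
    _ = _ := lintegral_lintegral_exp_mul hv hh
    _ ≤ _ := lintegral_enorm_mul_le hpq hh.aemeasurable
        (measurable_redWeight lam hv).aemeasurable

theorem stronglyMeasurable_Lap (lam : ℝ) {v f : ℝ → ℝ} (hv : Measurable v) (hf : Measurable f) :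
    StronglyMeasurable (Lap lam v f) := by
  unfold Lap
  refine StronglyMeasurable.integral_prod_right
    (f := fun x y => Real.exp (-(x * y ^ lam)) * f y * v y) ?_
  apply Measurable.stronglyMeasurable
  simp only [Function.uncurry_def]
  fun_prop

/-- Bounded sequences in `L^p` have weakly convergent subsequences, tested against `L^q`. -/
theorem exists_subseq_tendsto_integral_mul {p q : ℝ}
    (hpq : p.HolderConjugate q) {μ : Measure ℝ} [SFinite μ] {f : ℕ → ℝ → ℝ}
    (hf : ∀ n, Measurable (f n)) (hf1 : ∀ n, eLpNorm (f n) (ENNReal.ofReal p) μ ≤ 1) :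
    ∃ φ : ℕ → ℕ, StrictMono φ ∧ ∀ g : ℝ → ℝ, MemLp g (ENNReal.ofReal q) μ →
      ∃ l : ℝ, Tendsto (fun n => ∫ y, f (φ n) y * g y ∂μ) atTop (𝓝 l) := by
  have i1 : Fact (1 ≤ ENNReal.ofReal p) := ⟨by simpa using hpq.lt.le⟩
  have i2 : Fact (1 ≤ ENNReal.ofReal q) := ⟨by simpa using hpq.symm.lt.le⟩
  have i3 : Fact (ENNReal.ofReal q ≠ ⊤) := ⟨ENNReal.ofReal_ne_top⟩
  have i4 : (ENNReal.ofReal p).HolderConjugate (ENNReal.ofReal q) :=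
    hpq.ennrealOfReal
  have hm : ∀ n, MemLp (f n) (ENNReal.ofReal p) μ := fun n =>
    ⟨(hf n).aestronglyMeasurable, (hf1 n).trans_lt ENNReal.one_lt_top⟩
  let T := (ContinuousLinearMap.mul ℝ ℝ).lpPairing μ (ENNReal.ofReal p) (ENNReal.ofReal q)
  let x : ℕ → WeakDual ℝ (Lp ℝ (ENNReal.ofReal q) μ) := fun n =>
    StrongDual.toWeakDual (T ((hm n).toLp (f n)))
  have hx : ∀ n, x n ∈ WeakDual.toStrongDual ⁻¹' Metric.closedBall
      (0 : StrongDual ℝ (Lp ℝ (ENNReal.ofReal q) μ)) ‖T‖ := fun n => by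
    have : ‖T ((hm n).toLp (f n))‖ ≤ ‖T‖ * 1 := by
      refine T.le_opNorm_of_le ?_
      rw [Lp.norm_toLp]
      exact ENNReal.toReal_le_of_le_ofReal zero_le_one (by simpa using hf1 n)
    simpa [x] using this
  obtain ⟨a, -, φ, hφ, ha⟩ := WeakDual.isSeqCompact_closedBall ℝ _ _ _ hx
  refine ⟨φ, hφ, fun g hg => ⟨a (hg.toLp g), ?_⟩⟩
  have h := ((WeakDual.eval_continuous (hg.toLp g)).tendsto a).comp ha
  refine h.congr fun n => ?_
  change T ((hm (φ n)).toLp (f (φ n))) (hg.toLp g) = _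
  rw [ContinuousLinearMap.lpPairing_eq_integral]
  refine integral_congr_ae ?_
  filter_upwards [(hm (φ n)).coeFn_toLp, hg.coeFn_toLp] with y h1 h2
  simp [h1, h2]

theorem eLpNorm_kernel_le {lam q x C : ℝ} {v : ℝ → ℝ}
    (hC : ∀ y, 0 < y → v y ≠ 0 → Real.exp (-(x * y ^ lam)) * y ^ lam ≤ C) :
    eLpNorm (fun y => Real.exp (-(x * y ^ lam)) * v y) (ENNReal.ofReal q)
        (volume.restrict (Ioi 0))
      ≤ ENNReal.ofReal C
        * eLpNorm (redWeight lam v) (ENNReal.ofReal q) (volume.restrict (Ioi 0)) := by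
  refine eLpNorm_le_mul_eLpNorm_of_ae_le_mul ?_ _
  filter_upwards [ae_restrict_mem measurableSet_Ioi] with y hy
  have hy : 0 < y := hy
  by_cases h0 : v y = 0
  · simp [h0, redWeight]
  have e : v y = y ^ lam * redWeight lam v y := by
    rw [redWeight, ← mul_assoc, ← Real.rpow_add hy]; simp
  rw [e, ← mul_assoc, norm_mul, Real.norm_of_nonneg (by positivity)]
  exact mul_le_mul_of_nonneg_right (hC y hy h0) (norm_nonneg _)

theorem memLp_kernel {lam q x : ℝ} (hx : 0 < x) {v : ℝ → ℝ} (hv : Measurable v)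
    (hw : eLpNorm (redWeight lam v) (ENNReal.ofReal q) (volume.restrict (Ioi 0)) < ⊤) :
    MemLp (fun y => Real.exp (-(x * y ^ lam)) * v y) (ENNReal.ofReal q)
      (volume.restrict (Ioi 0)) := by
  refine ⟨Measurable.aestronglyMeasurable (by fun_prop),
    (eLpNorm_kernel_le (C := x⁻¹) fun y hy _ => ?_).trans_lt
      (ENNReal.mul_lt_top ENNReal.ofReal_lt_top hw)⟩
  have h := Real.add_one_le_exp (x * y ^ lam)
  rw [Real.exp_neg, ← div_eq_inv_mul, div_le_iff₀ (Real.exp_pos _), ← div_eq_inv_mul,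
    le_div_iff₀ hx]
  linarith [mul_comm x (y ^ lam)]

theorem integrable_Lap {lam p q x : ℝ} (hpq : p.HolderConjugate q) (hx : 0 < x) {v f : ℝ → ℝ}
    (hv : Measurable v)
    (hw : eLpNorm (redWeight lam v) (ENNReal.ofReal q) (volume.restrict (Ioi 0)) < ⊤)
    (hf : MemLp f (ENNReal.ofReal p) (volume.restrict (Ioi 0))) :
    IntegrableOn (fun y => Real.exp (-(x * y ^ lam)) * f y * v y) (Ioi 0) := by
  have : (ENNReal.ofReal p).HolderConjugate (ENNReal.ofReal q) := hpq.ennrealOfReal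
  refine (hf.integrable_mul (memLp_kernel hx hv hw)).congr (ae_of_all _ fun y => ?_)
  simp only [Pi.mul_apply]; ring

/-- For a weight supported in a compact subset of `(0,∞)`, weak convergence is turned into norm
convergence, by dominated convergence. -/
theorem exists_tendsto_eLpNorm_Lap_sub {lam p q a b : ℝ} (hlam : 0 < lam)
    (hpq : p.HolderConjugate q) (ha : 0 < a) {v : ℝ → ℝ} (hv : Measurable v)
    (hab : ∀ y, v y ≠ 0 → a ≤ y ∧ y ≤ b)
    (hw : eLpNorm (redWeight lam v) (ENNReal.ofReal q) (volume.restrict (Ioi 0)) < ⊤)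
    {f : ℕ → ℝ → ℝ} (hf : ∀ n, Measurable (f n))
    (hf1 : ∀ n, eLpNorm (f n) (ENNReal.ofReal p) (volume.restrict (Ioi 0)) ≤ 1)
    (hweak : ∀ g : ℝ → ℝ, MemLp g (ENNReal.ofReal q) (volume.restrict (Ioi 0)) →
      ∃ l : ℝ, Tendsto (fun n => ∫ y in Ioi 0, f n y * g y) atTop (𝓝 l)) :
    ∃ L : ℝ → ℝ, AEStronglyMeasurable L (volume.restrict (Ioi 0)) ∧
      Tendsto (fun n => eLpNorm (Lap lam v (f n) - L) 1 (volume.restrict (Ioi 0)))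
        atTop (𝓝 0) := by
  have hlim : ∀ x : ℝ, ∃ l : ℝ, 0 < x → Tendsto (fun n => Lap lam v (f n) x) atTop (𝓝 l) := by
    intro x
    by_cases hx : 0 < x
    · obtain ⟨l, hl⟩ := hweak _ (memLp_kernel hx hv hw)
      refine ⟨l, fun _ => hl.congr fun n => ?_⟩
      refine integral_congr_ae (ae_of_all _ fun y => ?_)
      ring
    · exact ⟨0, fun h => absurd h hx⟩
  choose L hL using hlim
  have hlimae : ∀ᵐ x ∂(volume.restrict (Ioi (0:ℝ))),
      Tendsto (fun n => Lap lam v (f n) x) atTop (𝓝 (L x)) := by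
    filter_upwards [ae_restrict_mem measurableSet_Ioi] with x hx using hL x hx
  have hmeas : ∀ n, AEStronglyMeasurable (Lap lam v (f n)) (volume.restrict (Ioi 0)) :=
    fun n => (stronglyMeasurable_Lap lam hv (hf n)).aestronglyMeasurable
  refine ⟨L, aestronglyMeasurable_of_tendsto_ae atTop hmeas hlimae, ?_⟩
  set B := (eLpNorm (redWeight lam v) (ENNReal.ofReal q) (volume.restrict (Ioi 0))).toReal
  have hbound : ∀ n, ∀ᵐ x ∂(volume.restrict (Ioi (0:ℝ))),
      ‖Lap lam v (f n) x‖ ≤ b ^ lam * B * Real.exp (-a ^ lam * x) := by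
    intro n
    filter_upwards [ae_restrict_mem measurableSet_Ioi] with x hx
    have hx : 0 < x := hx
    by_cases hb : 0 < b
    swap
    · have h0 : ∀ y, v y = 0 := fun y => by
        by_contra h
        have := hab y h
        linarith
      have hB : B = 0 := by
        have : redWeight lam v = 0 := by ext y; simp [redWeight, h0]
        simp [B, this]
      simp [Lap, h0, hB]
    have hk : eLpNorm (fun y => Real.exp (-(x * y ^ lam)) * v y) (ENNReal.ofReal q)
        (volume.restrict (Ioi 0)) ≤ ENNReal.ofReal (b ^ lam * Real.exp (-a ^ lam * x) ) *
        eLpNorm (redWeight lam v) (ENNReal.ofReal q) (volume.restrict (Ioi 0)) := by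
      refine eLpNorm_kernel_le fun y hy h0 => ?_
      obtain ⟨h1, h2⟩ := hab y h0
      rw [mul_comm]
      gcongr
      rw [neg_mul, mul_comm]
      gcongr
    have h : ‖Lap lam v (f n) x‖ₑ ≤ ENNReal.ofReal (b ^ lam * B * Real.exp (-a ^ lam * x)) := by
      calc ‖Lap lam v (f n) x‖ₑ
          ≤ ∫⁻ y in Ioi (0:ℝ), ‖Real.exp (-(x * y ^ lam)) * f n y * v y‖ₑ :=
            enorm_integral_le_lintegral_enorm _
        _ = ∫⁻ y in Ioi (0:ℝ), ‖f n y * (Real.exp (-(x * y ^ lam)) * v y)‖ₑ := by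
            refine lintegral_congr fun y => ?_
            congr 1; ring
        _ ≤ _ := lintegral_enorm_mul_le hpq (hf n).aemeasurable
            (Measurable.aemeasurable (by fun_prop))
        _ ≤ 1 * (ENNReal.ofReal (b ^ lam * Real.exp (-a ^ lam * x)) * ENNReal.ofReal B) := by
            rw [ENNReal.ofReal_toReal hw.ne]
            exact mul_le_mul' (hf1 n) hk
        _ = _ := by
            rw [one_mul, ← ENNReal.ofReal_mul (by positivity)]
            congr 1; ring
    rw [← ofReal_norm] at h
    exact (ENNReal.ofReal_le_ofReal_iff (by positivity)).1 h
  have := tendsto_lintegral_norm_of_dominated_convergence hmeas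
    (((exp_neg_integrableOn_Ioi 0 (Real.rpow_pos_of_pos ha lam)).const_mul
      (b ^ lam * B)).hasFiniteIntegral) hbound hlimae
  refine this.congr fun n => ?_
  rw [eLpNorm_one_eq_lintegral_enorm]
  exact lintegral_congr fun x => by rw [ofReal_norm]; rfl

theorem redWeight_indicator (lam : ℝ) (s : Set ℝ) (v : ℝ → ℝ) :
    redWeight lam (s.indicator v) = s.indicator (redWeight lam v) := by
  ext y
  by_cases h : y ∈ s <;> simp [redWeight, h]

theorem exists_Icc_eLpNorm_indicator_compl_lt {q : ℝ} (hq : 0 < q) {w : ℝ → ℝ}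
    (hwm : Measurable w)
    (hw : eLpNorm w (ENNReal.ofReal q) (volume.restrict (Ioi 0)) < ⊤) {ε : ℝ≥0∞} (hε : 0 < ε) :
    ∃ a b : ℝ, 0 < a ∧
      eLpNorm ((Icc a b)ᶜ.indicator w) (ENNReal.ofReal q) (volume.restrict (Ioi 0)) < ε := by
  have hI := lintegral_rpow_enorm_lt_top_of_eLpNorm_lt_top (by simpa using hq)
    ENNReal.ofReal_ne_top hw
  rw [ENNReal.toReal_ofReal hq.le] at hI
  have ht : Tendsto (fun n : ℕ => ∫⁻ y in Ioi (0:ℝ),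
      ‖(Icc ((n:ℝ) + 1)⁻¹ ((n:ℝ) + 1))ᶜ.indicator w y‖ₑ ^ q) atTop (𝓝 0) := by
    rw [← lintegral_zero (μ := volume.restrict (Ioi (0:ℝ)))]
    refine tendsto_lintegral_of_dominated_convergence _
      (fun n => ((hwm.indicator measurableSet_Icc.compl).enorm.pow_const q))
      (fun n => ae_of_all _ fun y => ?_) hI.ne ?_
    · exact ENNReal.rpow_le_rpow (enorm_indicator_le_enorm_self _ _) hq.le
    · filter_upwards [ae_restrict_mem measurableSet_Ioi] with y hy
      have hy : 0 < y := hy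
      refine tendsto_const_nhds.congr' ?_
      filter_upwards [eventually_ge_atTop (max ⌈y⌉₊ ⌈y⁻¹⌉₊)] with n hn
      have h1 : y ≤ n := (Nat.le_ceil y).trans (by exact_mod_cast (le_max_left _ _).trans hn)
      have h2 : y⁻¹ ≤ n := (Nat.le_ceil _).trans (by exact_mod_cast (le_max_right _ _).trans hn)
      have h3 : y ∈ Icc ((n:ℝ) + 1)⁻¹ ((n:ℝ) + 1) :=
        ⟨inv_le_of_inv_le₀ hy (by linarith), by linarith⟩
      rw [indicator_of_notMem (by simpa using h3)]
      simp [hq]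
  obtain ⟨n, hn⟩ := (ht.eventually (gt_mem_nhds (ENNReal.rpow_pos_of_nonneg hε hq.le))).exists
  refine ⟨((n:ℝ) + 1)⁻¹, (n:ℝ) + 1, by positivity, ?_⟩
  rw [eLpNorm_eq_lintegral_rpow_enorm_toReal (by simpa using hq) ENNReal.ofReal_ne_top,
    ENNReal.toReal_ofReal hq.le, one_div]
  exact (ENNReal.rpow_inv_lt_iff hq).2 hn

theorem lapCompact_of_eLpNorm_lt_top {lam p q : ℝ} (hlam : 0 < lam) (hpq : p.HolderConjugate q)
    {v : ℝ → ℝ} (hv : Measurable v)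
    (hw : eLpNorm (redWeight lam v) (ENNReal.ofReal q) (volume.restrict (Ioi 0)) < ⊤) :
    LapCompact lam p 1 v := by
  intro f hf hf1
  simp only [eN_eq_eLpNorm hpq.pos] at hf1
  obtain ⟨φ, hφ, hweak⟩ := exists_subseq_tendsto_integral_mul hpq hf hf1
  refine ⟨φ, hφ, fun ε hε => ?_⟩
  simp only [eN_eq_eLpNorm one_pos, ENNReal.ofReal_one]
  have hδ : (0:ℝ≥0∞) < ENNReal.ofReal (ε / 4) := by simpa using hε
  obtain ⟨a, b, ha, hab⟩ := exists_Icc_eLpNorm_indicator_compl_lt hpq.symm.pos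
    (measurable_redWeight lam hv) hw hδ
  set s := Icc a b
  have hs : MeasurableSet s := measurableSet_Icc
  have hws : eLpNorm (redWeight lam (s.indicator v)) (ENNReal.ofReal q)
      (volume.restrict (Ioi 0)) < ⊤ := by
    rw [redWeight_indicator]
    exact (eLpNorm_indicator_le _).trans_lt hw
  have hwc : eLpNorm (redWeight lam (sᶜ.indicator v)) (ENNReal.ofReal q)
      (volume.restrict (Ioi 0)) < ENNReal.ofReal (ε / 4) := by
    rwa [redWeight_indicator]
  obtain ⟨L, hLm, hL⟩ := exists_tendsto_eLpNorm_Lap_sub (a := a) (b := b) hlam hpq ha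
    (hv.indicator hs) (fun y hy => mem_Icc.1 (mem_of_indicator_ne_zero hy)) hws (fun n => hf (φ n))
    (fun n => hf1 (φ n)) hweak
  obtain ⟨N, hN⟩ := eventually_atTop.1 (hL.eventually (gt_mem_nhds hδ))
  refine ⟨N, fun m hm n hn => ?_⟩
  have hA : ∀ k, AEStronglyMeasurable (Lap lam (s.indicator v) (f k)) (volume.restrict (Ioi 0)) :=
    fun k => (stronglyMeasurable_Lap lam (hv.indicator hs) (hf k)).aestronglyMeasurable
  have hC : ∀ k, AEStronglyMeasurable (Lap lam (sᶜ.indicator v) (f k))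
      (volume.restrict (Ioi 0)) :=
    fun k => (stronglyMeasurable_Lap lam (hv.indicator hs.compl) (hf k)).aestronglyMeasurable
  have hCle : ∀ k, eLpNorm (Lap lam (sᶜ.indicator v) (f k)) 1 (volume.restrict (Ioi 0))
      < ENNReal.ofReal (ε / 4) := fun k => by
    refine (eLpNorm_one_Lap_le hpq (hv.indicator hs.compl) (hf k)).trans_lt ?_
    calc _ ≤ 1 * _ := mul_le_mul_left (hf1 k) _
      _ < _ := by rwa [one_mul]
  have hsplit : ∀ k x, 0 < x → Lap lam v (f k) x
      = Lap lam (s.indicator v) (f k) x + Lap lam (sᶜ.indicator v) (f k) x := by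
    intro k x hx
    have hfk : MemLp (f k) (ENNReal.ofReal p) (volume.restrict (Ioi 0)) :=
      ⟨(hf k).aestronglyMeasurable, (hf1 k).trans_lt ENNReal.one_lt_top⟩
    rw [Lap, Lap, Lap, ← integral_add
      (integrable_Lap hpq hx (hv.indicator hs) hws hfk)
      (integrable_Lap hpq hx (hv.indicator hs.compl) (hwc.trans ENNReal.ofReal_lt_top) hfk)]
    refine integral_congr_ae (ae_of_all _ fun y => ?_)
    simp only [← mul_add]
    rw [indicator_self_add_compl_apply]
  have hcongr : (fun x => Lap lam v (f (φ m)) x - Lap lam v (f (φ n)) x)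
      =ᵐ[volume.restrict (Ioi 0)]
      ((Lap lam (s.indicator v) (f (φ m)) - L) - (Lap lam (s.indicator v) (f (φ n)) - L))
        + (Lap lam (sᶜ.indicator v) (f (φ m)) - Lap lam (sᶜ.indicator v) (f (φ n))) := by
    filter_upwards [ae_restrict_mem measurableSet_Ioi] with x hx
    simp only [hsplit _ x hx, Pi.add_apply, Pi.sub_apply]
    ring
  rw [eLpNorm_congr_ae hcongr]
  calc _ ≤ _ := eLpNorm_add_le (((hA _).sub hLm).sub ((hA _).sub hLm)) ((hC _).sub (hC _)) le_rfl
    _ ≤ _ := add_le_add (eLpNorm_sub_le ((hA _).sub hLm) ((hA _).sub hLm) le_rfl)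
        (eLpNorm_sub_le (hC _) (hC _) le_rfl)
    _ < (ENNReal.ofReal (ε / 4) + ENNReal.ofReal (ε / 4))
        + (ENNReal.ofReal (ε / 4) + ENNReal.ofReal (ε / 4)) :=
      ENNReal.add_lt_add (ENNReal.add_lt_add (hN m hm) (hN n hn))
        (ENNReal.add_lt_add (hCle _) (hCle _))
    _ = ENNReal.ofReal ε := by
      rw [← ENNReal.ofReal_add (by positivity) (by positivity),
        ← ENNReal.ofReal_add (by positivity) (by positivity)]
      congr 1; ring

/-- For a nonnegative weight, the extremal function of Hölder's inequality for the truncated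
weight `redWeight lam v` on `s` shows that the operator norm is at least its `L^q` norm. -/
theorem exists_eN_Lap_eq {lam p q : ℝ} (hlam : 0 < lam) (hpq : p.HolderConjugate q) {v : ℝ → ℝ}
    (hv : Measurable v) (hvpos : ∀ y, 0 ≤ v y) {s : Set ℝ} (hs : MeasurableSet s) {b : ℝ}
    (hsb : ∀ y ∈ s, 0 < y ∧ y ≤ b)
    (hI : ∫⁻ y in Ioi (0:ℝ), ENNReal.ofReal (s.indicator (redWeight lam v) y) ^ q < ⊤) :
    ∃ f : ℝ → ℝ, Measurable f ∧ eN p f ≤ 1 ∧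
      eN 1 (Lap lam v f)
        = (∫⁻ y in Ioi (0:ℝ), ENNReal.ofReal (s.indicator (redWeight lam v) y) ^ q) ^ (1 / q) := by
  set w := s.indicator (redWeight lam v) with hwdef
  set I := ∫⁻ y in Ioi (0:ℝ), ENNReal.ofReal (w y) ^ q with hIdef
  have hp := hpq.pos
  have hq := hpq.symm.pos
  have hq1 := hpq.symm.lt
  have hwm : Measurable w := (measurable_redWeight lam hv).indicator hs
  have hw0 : ∀ y, 0 ≤ w y := fun y => indicator_nonneg (fun z hz =>
    mul_nonneg (Real.rpow_nonneg (hsb z hz).1.le _) (hvpos z)) y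
  set c : ℝ := I.toReal ^ (-(1 / p)) with hc
  have hc0 : 0 ≤ c := Real.rpow_nonneg ENNReal.toReal_nonneg _
  let f : ℝ → ℝ := fun y => c * w y ^ (q - 1)
  have hf0 : ∀ y, 0 ≤ f y := fun y => mul_nonneg hc0 (Real.rpow_nonneg (hw0 y) _)
  have hfm : Measurable f := by fun_prop
  have hcI : I ≠ 0 → ENNReal.ofReal c = I ^ (-(1 / p)) := fun h0 => by
    have : 0 < I.toReal := ENNReal.toReal_pos h0 hI.ne
    rw [hc, ← ENNReal.ofReal_rpow_of_pos this, ENNReal.ofReal_toReal hI.ne]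
  refine ⟨f, hfm, ?_, ?_⟩
  · have e : ∀ y, ENNReal.ofReal |f y| ^ p = ENNReal.ofReal c ^ p * ENNReal.ofReal (w y) ^ q := by
      intro y
      rw [abs_of_nonneg (hf0 y), ENNReal.ofReal_mul hc0, ENNReal.mul_rpow_of_nonneg _ _ hp.le,
        ← ENNReal.ofReal_rpow_of_nonneg (hw0 y) (by linarith), ← ENNReal.rpow_mul,
        hpq.symm.sub_one_mul_conj]
    rw [eN]
    simp only [e]
    rw [lintegral_const_mul _ (by fun_prop), ← hIdef]
    by_cases h0 : I = 0
    · rw [h0, mul_zero, ENNReal.zero_rpow_of_pos (by positivity)]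
      exact zero_le_one
    · rw [hcI h0, ← ENNReal.rpow_mul, neg_mul, one_div_mul_cancel hp.ne', ENNReal.rpow_neg_one,
        ENNReal.inv_mul_cancel h0 hI.ne, ENNReal.one_rpow]
  · have hint : IntegrableOn (fun y => w y ^ q) (Ioi 0) := by
      refine ⟨Measurable.aestronglyMeasurable (by fun_prop), ?_⟩
      rw [hasFiniteIntegral_iff_ofReal (ae_of_all _ fun y => Real.rpow_nonneg (hw0 y) _)]
      simpa only [← ENNReal.ofReal_rpow_of_nonneg (hw0 _) hq.le] using hI
    have hfv : ∀ y, f y * redWeight lam v y = c * w y ^ q := by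
      intro y
      by_cases hy : y ∈ s
      · have e : redWeight lam v y = w y := by rw [hwdef, indicator_of_mem hy]
        rw [e]
        simp only [f]
        rw [mul_assoc, ← Real.rpow_add_one' (hw0 y) (by simpa using hq.ne'), sub_add_cancel]
      · have e : w y = 0 := by rw [hwdef, indicator_of_notMem hy]
        simp only [f]
        rw [e, Real.zero_rpow (by linarith), Real.zero_rpow hq.ne']
        simp
    have hkint : ∀ x, 0 < x →
        IntegrableOn (fun y => Real.exp (-(x * y ^ lam)) * f y * v y) (Ioi 0) := by
      intro x hx
      refine Integrable.mono' (hint.const_mul (c * b ^ lam))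
        (Measurable.aestronglyMeasurable (by fun_prop)) ?_
      filter_upwards [ae_restrict_mem measurableSet_Ioi] with y hy
      have hy : 0 < y := hy
      rw [Real.norm_of_nonneg (mul_nonneg (mul_nonneg (Real.exp_pos _).le (hf0 y)) (hvpos y))]
      by_cases hys : y ∈ s
      · have e : v y = y ^ lam * redWeight lam v y := by
          rw [redWeight, ← mul_assoc, ← Real.rpow_add hy]; simp
        calc Real.exp (-(x * y ^ lam)) * f y * v y
            = Real.exp (-(x * y ^ lam)) * y ^ lam * (c * w y ^ q) := by
              rw [← hfv, e]; ring
          _ ≤ 1 * b ^ lam * (c * w y ^ q) := by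
              have h1 : Real.exp (-(x * y ^ lam)) ≤ 1 := Real.exp_le_one_iff.2 (by
                have : 0 ≤ x * y ^ lam := by positivity
                linarith)
              have h2 : y ^ lam ≤ b ^ lam := Real.rpow_le_rpow hy.le (hsb y hys).2 hlam.le
              have h3 : 0 ≤ c * w y ^ q := mul_nonneg hc0 (Real.rpow_nonneg (hw0 y) _)
              gcongr
          _ = _ := by ring
      · have e : w y = 0 := by rw [hwdef, indicator_of_notMem hys]
        simp only [f]
        rw [e, Real.zero_rpow (by linarith), Real.zero_rpow hq.ne']
        simp
    have hnonneg : ∀ x y, 0 ≤ Real.exp (-(x * y ^ lam)) * f y * v y := fun x y =>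
      mul_nonneg (mul_nonneg (Real.exp_pos _).le (hf0 y)) (hvpos y)
    calc eN 1 (Lap lam v f)
        = ∫⁻ x in Ioi (0:ℝ), ∫⁻ y in Ioi (0:ℝ), ‖Real.exp (-(x * y ^ lam)) * f y * v y‖ₑ := by
          rw [eN]
          simp only [ENNReal.rpow_one, div_one]
          refine setLIntegral_congr_fun measurableSet_Ioi fun x hx => ?_
          simp only [Real.enorm_of_nonneg (hnonneg _ _)]
          rw [Lap, abs_of_nonneg (integral_nonneg (hnonneg x)),
            ofReal_integral_eq_lintegral_ofReal (hkint x hx) (ae_of_all _ (hnonneg x))]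
      _ = ∫⁻ y in Ioi (0:ℝ), ‖f y * redWeight lam v y‖ₑ := lintegral_lintegral_exp_mul hv hfm
      _ = ∫⁻ y in Ioi (0:ℝ), ENNReal.ofReal c * ENNReal.ofReal (w y) ^ q := by
          refine lintegral_congr fun y => ?_
          rw [hfv, Real.enorm_of_nonneg (mul_nonneg hc0 (Real.rpow_nonneg (hw0 y) _)),
            ENNReal.ofReal_mul hc0, ENNReal.ofReal_rpow_of_nonneg (hw0 y) hq.le]
      _ = ENNReal.ofReal c * I := lintegral_const_mul _ (by fun_prop)
      _ = I ^ (1 / q) := by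
          by_cases h0 : I = 0
          · rw [h0, mul_zero, ENNReal.zero_rpow_of_pos (by positivity)]
          · have e : 1 / q = -(1 / p) + 1 := by
              have := hpq.inv_add_inv_eq_one
              simp only [one_div]; linarith
            rw [hcI h0, e, ENNReal.rpow_add _ _ h0 hI.ne, ENNReal.rpow_one]

/-- An exhaustion of `(0,∞)` by sets on which `y`, `1/y` and `v y` are bounded. -/
def truncSet (v : ℝ → ℝ) (n : ℕ) : Set ℝ :=
  Icc ((n:ℝ) + 1)⁻¹ ((n:ℝ) + 1) ∩ {y | v y ≤ n}

theorem measurableSet_truncSet {v : ℝ → ℝ} (hv : Measurable v) (n : ℕ) :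
    MeasurableSet (truncSet v n) :=
  measurableSet_Icc.inter (measurableSet_le hv measurable_const)

theorem truncSet_mono (v : ℝ → ℝ) : Monotone (truncSet v) := by
  intro m n hmn y hy
  have h : (m:ℝ) ≤ n := by exact_mod_cast hmn
  obtain ⟨⟨h1, h2⟩, h3⟩ := hy
  refine ⟨⟨le_trans ?_ h1, by linarith⟩, le_trans (show v y ≤ m from h3) h⟩
  gcongr

theorem eventually_mem_truncSet (v : ℝ → ℝ) {y : ℝ} (hy : 0 < y) :
    ∀ᶠ n in atTop, y ∈ truncSet v n := by
  filter_upwards [tendsto_natCast_atTop_atTop.eventually_ge_atTop y,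
    tendsto_natCast_atTop_atTop.eventually_ge_atTop y⁻¹,
    tendsto_natCast_atTop_atTop.eventually_ge_atTop (v y)] with n h1 h2 h3
  exact ⟨⟨inv_le_of_inv_le₀ hy (by linarith), by linarith⟩, h3⟩

theorem tendsto_lintegral_truncSet {q : ℝ} (hq : 0 < q) {v w : ℝ → ℝ} (hv : Measurable v)
    (hw : Measurable w) :
    Tendsto (fun n => ∫⁻ y in Ioi (0:ℝ), ENNReal.ofReal ((truncSet v n).indicator w y) ^ q)
      atTop (𝓝 (∫⁻ y in Ioi (0:ℝ), ENNReal.ofReal (w y) ^ q)) := by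
  have e : ∀ n y, ENNReal.ofReal ((truncSet v n).indicator w y) ^ q
      = (truncSet v n).indicator (fun y => ENNReal.ofReal (w y) ^ q) y := fun n y => by
    by_cases h : y ∈ truncSet v n <;> simp [h, hq]
  simp only [e]
  refine lintegral_tendsto_of_tendsto_of_monotone
    (fun n => (Measurable.indicator (by fun_prop) (measurableSet_truncSet hv n)).aemeasurable)
    (ae_of_all _ fun y m n hmn => ?_) ?_
  · exact indicator_le_indicator_of_subset (truncSet_mono v hmn) (fun _ => zero_le) y
  · filter_upwards [ae_restrict_mem measurableSet_Ioi] with y hy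
    refine tendsto_const_nhds.congr' ?_
    filter_upwards [eventually_mem_truncSet v hy] with n hn
    rw [indicator_of_mem hn]

theorem lintegral_truncSet_lt_top {lam q : ℝ} (hlam : 0 < lam) (hq : 0 < q) {v : ℝ → ℝ}
    (hvpos : ∀ y, 0 ≤ v y) (n : ℕ) :
    ∫⁻ y in Ioi (0:ℝ), ENNReal.ofReal ((truncSet v n).indicator (redWeight lam v) y) ^ q < ⊤ := by
  have hn : (0:ℝ) < (n:ℝ) + 1 := by positivity
  calc _ ≤ ∫⁻ y, (Icc ((n:ℝ) + 1)⁻¹ ((n:ℝ) + 1)).indicator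
          (fun _ => ENNReal.ofReal (((n:ℝ) + 1) ^ lam * n) ^ q) y := by
        refine (lintegral_mono fun y => ?_).trans (setLIntegral_le_lintegral _ _)
        by_cases h : y ∈ truncSet v n
        · rw [indicator_of_mem h, indicator_of_mem h.1]
          refine ENNReal.rpow_le_rpow (ENNReal.ofReal_le_ofReal ?_) hq.le
          obtain ⟨⟨h1, h2⟩, h3⟩ := h
          have hy : 0 < y := lt_of_lt_of_le (by positivity) h1
          refine mul_le_mul ?_ h3 (hvpos y) (by positivity)
          rw [Real.rpow_neg hy.le, ← Real.inv_rpow hy.le]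
          exact Real.rpow_le_rpow (by positivity) (inv_le_of_inv_le₀ hn h1) hlam.le
        · simp [h, hq]
    _ < ⊤ := by
        rw [lintegral_indicator measurableSet_Icc, setLIntegral_const, Real.volume_Icc]
        exact ENNReal.mul_lt_top (ENNReal.rpow_lt_top_of_nonneg hq.le ENNReal.ofReal_ne_top)
          ENNReal.ofReal_lt_top

theorem lintegral_redWeight_lt_top_of_lapCompact {lam p q : ℝ} (hlam : 0 < lam)
    (hpq : p.HolderConjugate q) {v : ℝ → ℝ} (hv : Measurable v) (hvpos : ∀ y, 0 ≤ v y)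
    (hcomp : LapCompact lam p 1 v) :
    ∫⁻ y in Ioi (0:ℝ), ENNReal.ofReal (redWeight lam v y) ^ q < ⊤ := by
  by_contra! htop
  rw [top_le_iff] at htop
  have hq := hpq.symm.pos
  choose f hfm hf1 hfL using fun n : ℕ => exists_eN_Lap_eq (b := (n:ℝ) + 1) hlam hpq hv hvpos
    (measurableSet_truncSet hv n)
    (fun y hy => ⟨lt_of_lt_of_le (by positivity) hy.1.1, hy.1.2⟩)
    (lintegral_truncSet_lt_top hlam hq hvpos n)
  have hlim := tendsto_lintegral_truncSet hq hv (measurable_redWeight lam hv)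
  rw [htop] at hlim
  have hlim' : Tendsto (fun n => eN 1 (Lap lam v (f n))) atTop (𝓝 ⊤) := by
    have h := ((ENNReal.continuous_rpow_const (y := 1 / q)).tendsto ⊤).comp hlim
    rw [ENNReal.top_rpow_of_pos (by positivity)] at h
    exact h.congr fun n => (hfL n).symm
  obtain ⟨φ, hφ, hcauchy⟩ := hcomp f hfm hf1
  obtain ⟨N, hN⟩ := hcauchy 1 one_pos
  have hfin : eN 1 (Lap lam v (f (φ N))) < ⊤ := by
    rw [hfL]
    exact ENNReal.rpow_lt_top_of_nonneg (by positivity)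
      (lintegral_truncSet_lt_top hlam hq hvpos _).ne
  have hbdd : ∀ n, N ≤ n → eN 1 (Lap lam v (f (φ n)))
      ≤ ENNReal.ofReal 1 + eN 1 (Lap lam v (f (φ N))) := fun n hn => by
    have h := (hN n hn N le_rfl).le
    rw [eN_eq_eLpNorm one_pos, ENNReal.ofReal_one] at h ⊢
    rw [eN_eq_eLpNorm one_pos, ENNReal.ofReal_one]
    have hA := fun k => (stronglyMeasurable_Lap lam hv (hfm k)).aestronglyMeasurable
      (μ := volume.restrict (Ioi 0))
    calc _ = eLpNorm ((fun x => Lap lam v (f (φ n)) x - Lap lam v (f (φ N)) x)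
          + Lap lam v (f (φ N))) 1 (volume.restrict (Ioi 0)) := by
          congr 1; ext x; simp
      _ ≤ _ := eLpNorm_add_le ((hA _).sub (hA _)) (hA _) le_rfl
      _ ≤ _ := add_le_add_left h _
  have h1 := (hlim'.comp hφ.tendsto_atTop).eventually
    (lt_mem_nhds (ENNReal.add_lt_top.2 ⟨ENNReal.ofReal_lt_top (r := 1), hfin⟩))
  obtain ⟨n, hn1, hn2⟩ := (h1.and (eventually_ge_atTop N)).exists
  exact absurd hn1 (not_lt.2 (hbdd n hn2))

theorem stmt7 (lam p : ℝ) (hlam : 0 < lam) (hp1 : 1 < p)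
    (v : ℝ → ℝ) (hv : Measurable v) (hvpos : ∀ y, 0 ≤ v y)
    (p' : ℝ) (hp' : p' = p / (p - 1))
    (Bp : ℝ≥0∞)
    -- `B_p = (∫_0^∞ y^{-λp'} v(y)^{p'} dy)^{1/p'}`
    (hBp : Bp = (∫⁻ y in Ioi (0:ℝ),
      (ENNReal.ofReal y) ^ (-(lam * p')) * ENNReal.ofReal (v y) ^ p') ^ (1/p')) :
    LapCompact lam p 1 v ↔ Bp < ⊤ := by
  have hpq : p.HolderConjugate p' := by
    rw [hp']
    exact Real.HolderConjugate.conjExponent hp1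
  have hq := hpq.symm.pos
  have hI : ∫⁻ y in Ioi (0:ℝ), (ENNReal.ofReal y) ^ (-(lam * p')) * ENNReal.ofReal (v y) ^ p'
      = ∫⁻ y in Ioi (0:ℝ), ENNReal.ofReal (redWeight lam v y) ^ p' := by
    refine setLIntegral_congr_fun measurableSet_Ioi fun y hy => ?_
    have hy : 0 < y := hy
    simp only [redWeight]
    rw [ENNReal.ofReal_mul (by positivity), ENNReal.mul_rpow_of_nonneg _ _ hq.le,
      ← ENNReal.ofReal_rpow_of_pos hy, ← ENNReal.rpow_mul, neg_mul]
  rw [hBp, hI]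
  constructor
  · intro h
    exact ENNReal.rpow_lt_top_of_nonneg (by positivity)
      (lintegral_redWeight_lt_top_of_lapCompact hlam hpq hv hvpos h).ne
  · intro h
    refine lapCompact_of_eLpNorm_lt_top hlam hpq hv ?_
    rw [← eN_eq_eLpNorm hq, eN]
    refine lt_of_eq_of_lt ?_ h
    congr 1
    refine setLIntegral_congr_fun measurableSet_Ioi fun y hy => ?_
    have h0 : 0 ≤ redWeight lam v y := mul_nonneg (Real.rpow_nonneg (le_of_lt hy) _) (hvpos y)
    simp only [abs_of_nonneg h0]
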